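/- Let ψ: (1,∞) → (0,∞) be an unbounded strictly increasing function, let d ∈ R^3 be nonzero, and let δ > 0. Then there exists a unit vector u ∈ R^3 with Q-linearly independent coordinates such that |x·u| ≥ 1/(ψ(||x||) ||x||^γ) for every x ∈ Z^3 of sufficiently large norm with dist(x,d) > δ, where γ = (1+√5)/2 and dist is the projective distance. -/

import Mathlib

noncomputable section

/-- Cross product in ℝ³. -/
def cross3 (x y : Fin 3 → ℝ) : Fin 3 → ℝ :=
  ![x 1 * y 2 - x 2 * y 1, x 2 * y 0 - x 0 * y 2, x 0 * y 1 - x 1 * y 0]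

/-- Scalar product in ℝ³. -/
def dot3 (x y : Fin 3 → ℝ) : ℝ := x 0 * y 0 + x 1 * y 1 + x 2 * y 2

/-- Euclidean norm in ℝ³. -/
def nrm (x : Fin 3 → ℝ) : ℝ := Real.sqrt (dot3 x x)

/-- Projective distance between nonzero vectors of ℝ³. -/
def pdist (x y : Fin 3 → ℝ) : ℝ := nrm (cross3 x y) / (nrm x * nrm y)

/-- The canonical map ℤ³ → ℝ³. -/
def toR (x : Fin 3 → ℤ) : Fin 3 → ℝ := fun i => (x i : ℝ)

/-- Determinant of three vectors of ℝ³. -/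
def det3 (a b c : Fin 3 → ℝ) : ℝ :=
  a 0 * (b 1 * c 2 - b 2 * c 1) - a 1 * (b 0 * c 2 - b 2 * c 0) + a 2 * (b 0 * c 1 - b 1 * c 0)

/-- Determinant of three vectors of ℤ³. -/
def det3Z (a b c : Fin 3 → ℤ) : ℤ :=
  a 0 * (b 1 * c 2 - b 2 * c 1) - a 1 * (b 0 * c 2 - b 2 * c 0) + a 2 * (b 0 * c 1 - b 1 * c 0)

/-- Cross product of integer vectors. -/
def crossZ (x y : Fin 3 → ℤ) : Fin 3 → ℤ :=
  ![x 1 * y 2 - x 2 * y 1, x 2 * y 0 - x 0 * y 2, x 0 * y 1 - x 1 * y 0]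

/-- A point of ℤ³ is primitive if its coordinates are coprime (in particular it is nonzero). -/
def IsPrimitive (x : Fin 3 → ℤ) : Prop := Int.gcd (Int.gcd (x 0) (x 1)) (x 2) = 1

/-- A pair of points of ℤ³ is primitive if their cross product is a primitive point. -/
def PrimPair (x y : Fin 3 → ℤ) : Prop := IsPrimitive (crossZ x y)

/-- The golden ratio. -/
def γ : ℝ := (1 + Real.sqrt 5) / 2

theorem dot3_comm (a b : Fin 3 → ℝ) : dot3 a b = dot3 b a := by unfold dot3; ring

theorem dot3_self_nonneg (a : Fin 3 → ℝ) : 0 ≤ dot3 a a := by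
  unfold dot3; nlinarith [mul_self_nonneg (a 0), mul_self_nonneg (a 1), mul_self_nonneg (a 2)]

theorem nrm_nonneg (a : Fin 3 → ℝ) : 0 ≤ nrm a := Real.sqrt_nonneg _

theorem nrm_sq (a : Fin 3 → ℝ) : nrm a ^ 2 = dot3 a a := Real.sq_sqrt (dot3_self_nonneg a)

theorem lagrange3 (a b : Fin 3 → ℝ) :
    nrm (cross3 a b) ^ 2 + dot3 a b ^ 2 = nrm a ^ 2 * nrm b ^ 2 := by
  rw [nrm_sq, nrm_sq, nrm_sq]; simp [dot3, cross3]; ring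

theorem abs_dot3_le (a b : Fin 3 → ℝ) : |dot3 a b| ≤ nrm a * nrm b := by
  apply abs_le_of_sq_le_sq _ (mul_nonneg (nrm_nonneg a) (nrm_nonneg b))
  nlinarith [lagrange3 a b, sq_nonneg (nrm (cross3 a b))]

theorem nrm_cross_le (a b : Fin 3 → ℝ) : nrm (cross3 a b) ≤ nrm a * nrm b := by
  apply le_of_sq_le_sq _ (mul_nonneg (nrm_nonneg a) (nrm_nonneg b))
  nlinarith [lagrange3 a b, sq_nonneg (dot3 a b)]

theorem nrm_cross_comm (a b : Fin 3 → ℝ) : nrm (cross3 a b) = nrm (cross3 b a) := by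
  unfold nrm; congr 1; simp [dot3, cross3]; ring

theorem nrm_smul3 (c : ℝ) (a : Fin 3 → ℝ) : nrm (c • a) = |c| * nrm a := by
  unfold nrm
  rw [← Real.sqrt_sq_eq_abs, ← Real.sqrt_mul (sq_nonneg c)]
  congr 1; simp [dot3]; ring

theorem nrm_add_le (a b : Fin 3 → ℝ) : nrm (a + b) ≤ nrm a + nrm b := by
  apply le_of_sq_le_sq _ (add_nonneg (nrm_nonneg a) (nrm_nonneg b))
  have h : nrm (a + b) ^ 2 = nrm a ^ 2 + nrm b ^ 2 + 2 * dot3 a b := by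
    rw [nrm_sq, nrm_sq, nrm_sq]; simp [dot3]; ring
  nlinarith [(abs_le.mp (abs_dot3_le a b)).2]

theorem abs_le_nrm (a : Fin 3 → ℝ) (i : Fin 3) : |a i| ≤ nrm a := by
  apply abs_le_of_sq_le_sq _ (nrm_nonneg a)
  rw [nrm_sq]; unfold dot3
  fin_cases i <;> simp <;>
    nlinarith [mul_self_nonneg (a 0), mul_self_nonneg (a 1), mul_self_nonneg (a 2)]

theorem nrm_eq_zero {a : Fin 3 → ℝ} (h : nrm a = 0) : a = 0 := by
  funext i
  have := abs_le_nrm a i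
  rw [h] at this
  simpa using this

/-- triangle inequality for the sine distance -/
theorem sine_triangle (x y d : Fin 3 → ℝ) :
    nrm y * nrm (cross3 x d) ≤ nrm x * nrm (cross3 y d) + nrm d * nrm (cross3 x y) := by
  rcases (nrm_nonneg y).eq_or_lt with h | h
  · rw [← h, zero_mul]
    exact add_nonneg (mul_nonneg (nrm_nonneg _) (nrm_nonneg _))
      (mul_nonneg (nrm_nonneg _) (nrm_nonneg _))
  have e : (dot3 y y) • cross3 x d
      = (dot3 d y) • cross3 x y + cross3 x (cross3 (cross3 y d) y) := by
    funext i
    fin_cases i <;> simp [dot3, cross3] <;> ring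
  have h1 : nrm y ^ 2 * nrm (cross3 x d)
      ≤ |dot3 d y| * nrm (cross3 x y) + nrm x * (nrm (cross3 y d) * nrm y) := by
    have := congrArg nrm e
    rw [nrm_smul3, ← nrm_sq, abs_of_nonneg (sq_nonneg _)] at this
    rw [this]
    refine (nrm_add_le _ _).trans ?_
    rw [nrm_smul3]
    have h2 := nrm_cross_le x (cross3 (cross3 y d) y)
    have h3 := nrm_cross_le (cross3 y d) y
    have := mul_le_mul_of_nonneg_left h3 (nrm_nonneg x)
    linarith
  have h4 := mul_le_mul_of_nonneg_right (abs_dot3_le d y) (nrm_nonneg (cross3 x y))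
  have : nrm y * (nrm y * nrm (cross3 x d)) ≤
    nrm y * (nrm x * nrm (cross3 y d) + nrm d * nrm (cross3 x y)) := by nlinarith
  exact le_of_mul_le_mul_left this h

theorem binet (x W v : Fin 3 → ℝ) :
    nrm v * |dot3 x W| ≤ |dot3 x v| * nrm W + nrm x * nrm (cross3 v W) := by
  rcases (nrm_nonneg v).eq_or_lt with h | h
  · rw [← h, zero_mul]
    exact add_nonneg (mul_nonneg (abs_nonneg _) (nrm_nonneg _))
      (mul_nonneg (nrm_nonneg _) (nrm_nonneg _))
  have e : nrm v ^ 2 * dot3 x W = dot3 x v * dot3 W v + dot3 (cross3 v x) (cross3 v W) := by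
    rw [nrm_sq]; simp [dot3, cross3]; ring
  have h1 : nrm v ^ 2 * |dot3 x W| ≤
      |dot3 x v| * (nrm W * nrm v) + (nrm v * nrm x) * nrm (cross3 v W) := by
    rw [← abs_of_nonneg (sq_nonneg (nrm v)), ← abs_mul, e]
    refine (abs_add_le _ _).trans ?_
    rw [abs_mul]
    refine add_le_add (mul_le_mul_of_nonneg_left (abs_dot3_le _ _) (abs_nonneg _)) ?_
    exact (abs_dot3_le _ _).trans (mul_le_mul_of_nonneg_right (nrm_cross_le _ _) (nrm_nonneg _))
  have : nrm v * (nrm v * |dot3 x W|) ≤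
    nrm v * (|dot3 x v| * nrm W + nrm x * nrm (cross3 v W)) := by nlinarith
  exact le_of_mul_le_mul_left this h

/-- normalization -/
def unitv (a : Fin 3 → ℝ) : Fin 3 → ℝ := (nrm a)⁻¹ • a

theorem nrm_unitv {a : Fin 3 → ℝ} (h : 0 < nrm a) : nrm (unitv a) = 1 := by
  unfold unitv
  rw [nrm_smul3, abs_of_pos (inv_pos.mpr h), inv_mul_cancel₀ h.ne']

theorem dot3_smul (x a : Fin 3 → ℝ) (c : ℝ) : dot3 x (c • a) = c * dot3 x a := by
  simp [dot3]; ring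

theorem dot3_unitv (x a : Fin 3 → ℝ) : dot3 x (unitv a) = dot3 x a / nrm a := by
  unfold unitv; rw [dot3_smul]; ring

theorem unitv_close {a b : Fin 3 → ℝ} (ha : 0 < nrm a) (hb : 0 < nrm b) (h : 0 ≤ dot3 a b) :
    nrm (unitv a - unitv b) ≤ 2 * nrm (cross3 a b) / (nrm a * nrm b) := by
  have hA := nrm_unitv ha
  have hB := nrm_unitv hb
  have h1 : nrm (unitv a - unitv b) ^ 2 = 2 - 2 * dot3 (unitv a) (unitv b) := by
    have e : nrm (unitv a - unitv b) ^ 2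
        = nrm (unitv a) ^ 2 + nrm (unitv b) ^ 2 - 2 * dot3 (unitv a) (unitv b) := by
      rw [nrm_sq, nrm_sq, nrm_sq]; simp [dot3]; ring
    rw [e, hA, hB]; norm_num
  have h2 : nrm (cross3 (unitv a) (unitv b)) = nrm (cross3 a b) / (nrm a * nrm b) := by
    have : cross3 (unitv a) (unitv b) = ((nrm a)⁻¹ * (nrm b)⁻¹) • cross3 a b := by
      funext i
      fin_cases i <;> simp [cross3, unitv] <;> ring
    rw [this, nrm_smul3, abs_of_pos (mul_pos (inv_pos.mpr ha) (inv_pos.mpr hb))]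
    field_simp
  have h3 := lagrange3 (unitv a) (unitv b)
  rw [hA, hB] at h3
  have h4 : 0 ≤ dot3 (unitv a) (unitv b) := by
    rw [dot3_unitv, dot3_comm, dot3_unitv, dot3_comm]; positivity
  have h5 : dot3 (unitv a) (unitv b) ≤ 1 := by
    have := (abs_le.mp (abs_dot3_le (unitv a) (unitv b))).2
    rw [hA, hB] at this; linarith
  rw [mul_div_assoc, ← h2]
  apply le_of_sq_le_sq _ (mul_nonneg (by norm_num) (nrm_nonneg _))
  nlinarith


def dotZ (x y : Fin 3 → ℤ) : ℤ := x 0 * y 0 + x 1 * y 1 + x 2 * y 2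

theorem dot_toR (x y : Fin 3 → ℤ) : dot3 (toR x) (toR y) = (dotZ x y : ℝ) := by
  simp [dot3, toR, dotZ]

theorem cross_toR (x y : Fin 3 → ℤ) : cross3 (toR x) (toR y) = toR (crossZ x y) := by
  funext i
  fin_cases i <;> simp [cross3, toR, crossZ]

theorem one_le_nrm {x : Fin 3 → ℤ} (h : x ≠ 0) : 1 ≤ nrm (toR x) := by
  have : ∃ i, x i ≠ 0 := by
    by_contra hc; push Not at hc; exact h (funext hc)
  obtain ⟨i, hi⟩ := this
  have h1 := abs_le_nrm (toR x) i
  have h2 : (1 : ℝ) ≤ |toR x i| := by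
    simp only [toR]; exact_mod_cast Int.one_le_abs hi
  linarith

theorem sqrt2_lower (a b : ℤ) (h : ¬ (a = 0 ∧ b = 0)) :
    (a ≠ 0 → 1 ≤ 4 * |(a : ℝ)| * |Real.sqrt 2 * a + b|) ∧ Real.sqrt 2 * a + b ≠ 0 ∧
    (a = 0 → 1 ≤ |Real.sqrt 2 * a + b|) := by
  have key : a ≠ 0 → 1 ≤ 4 * |(a : ℝ)| * |Real.sqrt 2 * a + b| := by
    intro ha
    have h2 : Real.sqrt 2 * Real.sqrt 2 = 2 := Real.mul_self_sqrt (by norm_num)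
    have hs : Real.sqrt 2 < 1.42 := by
      rw [Real.sqrt_lt' (by norm_num)]; norm_num
    have hs0 := Real.sqrt_nonneg 2
    have ha1 : (1 : ℝ) ≤ |(a : ℝ)| := by exact_mod_cast Int.one_le_abs ha
    by_cases hl : 1 ≤ |Real.sqrt 2 * a + b|
    · nlinarith
    push Not at hl
    have hne : b ^ 2 - 2 * a ^ 2 ≠ 0 := by
      intro h0
      have hirr := irrational_sqrt_two
      apply hirr
      have h0' : (b : ℝ) ^ 2 = 2 * (a : ℝ) ^ 2 := by exact_mod_cast (by linarith : b ^ 2 = 2 * a ^ 2)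
      have ha0 : (a : ℝ) ≠ 0 := by exact_mod_cast ha
      refine ⟨|(b : ℚ) / a|, ?_⟩
      push_cast
      symm
      rw [Real.sqrt_eq_iff_mul_self_eq (by norm_num) (abs_nonneg _), abs_mul_abs_self]
      field_simp; linarith
    have hge : (1 : ℝ) ≤ |(b : ℝ) ^ 2 - 2 * (a : ℝ) ^ 2| := by
      exact_mod_cast Int.one_le_abs hne
    have hf : (b : ℝ) ^ 2 - 2 * (a : ℝ) ^ 2 = (Real.sqrt 2 * a + b) * (b - Real.sqrt 2 * a) := by
      linear_combination (a : ℝ) ^ 2 * h2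
    rw [hf, abs_mul] at hge
    have hu : |(b : ℝ) - Real.sqrt 2 * a| ≤ 4 * |(a : ℝ)| := by
      have : (b : ℝ) - Real.sqrt 2 * a = (Real.sqrt 2 * a + b) - 2 * Real.sqrt 2 * a := by ring
      rw [this]
      refine (abs_sub _ _).trans ?_
      rw [abs_mul, abs_of_nonneg (by positivity : 0 ≤ 2 * Real.sqrt 2)]
      nlinarith
    have := mul_le_mul_of_nonneg_left hu (abs_nonneg (Real.sqrt 2 * a + b))
    linarith
  have k3 : a = 0 → 1 ≤ |Real.sqrt 2 * a + b| := by
    intro ha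
    have hb : b ≠ 0 := fun hb => h ⟨ha, hb⟩
    subst ha
    simp only [Int.cast_zero, mul_zero, zero_add]
    exact_mod_cast Int.one_le_abs hb
  refine ⟨key, ?_, k3⟩
  intro h0
  by_cases ha : a = 0
  · have := k3 ha; rw [h0] at this; norm_num at this
  · have := key ha; rw [h0] at this; norm_num at this

theorem pell (Q : ℕ) : ∃ p q : ℤ, p ^ 2 - 2 * q ^ 2 = 1 ∧ (Q : ℤ) ≤ q ∧ 0 < p ∧ 0 < q := by
  induction Q with
  | zero => exact ⟨3, 2, by norm_num, by norm_num, by norm_num, by norm_num⟩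
  | succ n ih =>
    obtain ⟨p, q, h, hq, hp, hq0⟩ := ih
    refine ⟨3 * p + 4 * q, 2 * p + 3 * q, by linear_combination h, ?_, by linarith, by linarith⟩
    push_cast; linarith


theorem crossZ_triple (a b c : Fin 3 → ℤ) :
    crossZ a (crossZ b c) = dotZ a c • b - dotZ a b • c := by
  funext i
  fin_cases i <;> simp [dotZ, crossZ] <;> ring

theorem crossZ_anti (a b : Fin 3 → ℤ) : crossZ a b = - crossZ b a := by
  funext i
  fin_cases i <;> simp [crossZ] <;> ring

/-- the main algebraic step -/
theorem alg_step (w r s : Fin 3 → ℤ) (hs : dotZ s (crossZ r w) = 1) (p q : ℤ)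
    (hpq : p ^ 2 - 2 * q ^ 2 = 1) :
    ∃ z e : Fin 3 → ℤ, dotZ e (p • w + q • r) = 1 ∧ ∀ M : ℤ,
      crossZ (z + M • crossZ r w) (crossZ r w) = p • w + q • r ∧
      ∃ s' R₀ : Fin 3 → ℤ, dotZ s' (z + M • crossZ r w) = 1 ∧
      ∀ k : ℤ, crossZ (R₀ + k • (p • w + q • r)) (p • w + q • r) = z + M • crossZ r w := by
  have hs' := hs
  simp [dotZ, crossZ] at hs'
  have he : dotZ (p • crossZ s r - (2 * q) • crossZ w s) (p • w + q • r) = 1 := by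
    simp [dotZ, crossZ]
    linear_combination (p ^ 2 - 2 * q ^ 2) * hs' + hpq
  refine ⟨q • crossZ s r - p • crossZ w s, p • crossZ s r - (2 * q) • crossZ w s, he, ?_⟩
  intro M
  refine ⟨?_, -(p • r + (2 * q) • w), crossZ (p • crossZ s r - (2 * q) • crossZ w s)
    (q • crossZ s r - p • crossZ w s + M • crossZ r w), ?_, ?_⟩
  · funext i
    fin_cases i <;> simp [crossZ]
    · linear_combination (p * w 0 + q * r 0) * hs'
    · linear_combination (p * w 1 + q * r 1) * hs'
    · linear_combination (p * w 2 + q * r 2) * hs'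
  · simp [dotZ, crossZ]
    linear_combination (p ^ 2 - 2 * q ^ 2) * hs' + hpq
  · intro k
    set e := p • crossZ s r - (2 * q) • crossZ w s with hedef
    set W := p • w + q • r with hW
    set y' := q • crossZ s r - p • crossZ w s + M • crossZ r w with hy'
    have h0 : dotZ y' W = 0 := by
      simp [hy', hW, dotZ, crossZ]; ring
    have h1 : crossZ (crossZ e y' + k • W) W = crossZ (crossZ e y') W := by
      funext i
      fin_cases i <;> simp [crossZ] <;> ring
    have h2 : dotZ W y' = 0 := by rw [← h0]; unfold dotZ; ring
    have h3 : dotZ W e = 1 := by rw [← he]; unfold dotZ; ring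
    rw [h1, crossZ_anti, crossZ_triple, h2, h3]
    simp

theorem gamma_sq : γ ^ 2 = γ + 1 := by
  unfold γ
  have : Real.sqrt 5 ^ 2 = 5 := Real.sq_sqrt (by norm_num)
  linear_combination this / 4

theorem gamma_gt : 1 < γ := by
  unfold γ
  have : 2 < Real.sqrt 5 := by rw [Real.lt_sqrt (by norm_num)]; norm_num
  linarith

theorem gamma_lt : γ < 2 := by
  unfold γ
  have : Real.sqrt 5 < 3 := by rw [Real.sqrt_lt' (by norm_num)]; norm_num
  linarith

theorem num_final {ψ X t m : ℝ} (hX : 0 < X) (hm : 0 < m) (hψ : 1 / m < ψ)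
    (h : m ≤ t * X ^ γ) : 1 / (ψ * X ^ γ) < t := by
  have hp : 0 < X ^ γ := Real.rpow_pos_of_pos hX _
  have hψ0 : 0 < ψ := lt_trans (by positivity) hψ
  rw [div_lt_iff₀ (by positivity)]
  rw [div_lt_iff₀ hm] at hψ
  nlinarith

theorem num_lin {X t m : ℝ} (hX : 1 ≤ X) (ht : 0 ≤ t) (h : m ≤ t * X) : m ≤ t * X ^ γ := by
  have : X ≤ X ^ γ := by
    conv_lhs => rw [← Real.rpow_one X]
    exact Real.rpow_le_rpow_of_exponent_le hX gamma_gt.le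
  nlinarith

theorem num_ii {X t K D : ℝ} (hD : 0 < D) (hK : 1 ≤ K) (hX : D ^ γ / (2 * K) ≤ X)
    (h : 1 / (40 * K * D * X) ≤ t) : 1 / (80 * K ^ 2) ≤ t * X ^ γ := by
  have hDp : 0 < D ^ γ := Real.rpow_pos_of_pos hD _
  have hX0 : 0 < X := lt_of_lt_of_le (by positivity) hX
  have hXg : X ^ γ = X * X ^ (γ - 1) := by
    rw [Real.rpow_sub_one hX0.ne']; field_simp
  have hg := gamma_gt
  have hg2 := gamma_lt
  have h1 : D / (2 * K) ≤ X ^ (γ - 1) := by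
    have h2 : (D ^ γ / (2 * K)) ^ (γ - 1) ≤ X ^ (γ - 1) :=
      Real.rpow_le_rpow (by positivity) hX (by linarith)
    refine le_trans ?_ h2
    rw [Real.div_rpow hDp.le (by positivity), ← Real.rpow_mul hD.le]
    have : γ * (γ - 1) = 1 := by linear_combination gamma_sq
    rw [this, Real.rpow_one]
    apply div_le_div_of_nonneg_left hD.le (by positivity)
    conv_rhs => rw [← Real.rpow_one (2 * K)]
    exact Real.rpow_le_rpow_of_exponent_le (by linarith) (by linarith)
  have h3 : 1 / (40 * K * D * X) * (X * (D / (2 * K))) = 1 / (80 * K ^ 2) := by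
    field_simp; norm_num
  rw [← h3, hXg]
  apply mul_le_mul h (by gcongr) (by positivity)
  exact le_trans (by positivity) h

theorem num_P {X t Y D : ℝ} (hD : 0 < D) (hY : 0 < Y) (hX : D / Y ≤ X)
    (h : X / (5 * D ^ γ * D) ≤ t) : 1 / (5 * Y ^ (1 + γ)) ≤ t * X ^ γ := by
  have hX0 : 0 < X := lt_of_lt_of_le (by positivity) hX
  have hg := gamma_gt
  have h1 : (D / Y) ^ (1 + γ) ≤ X ^ (1 + γ) :=
    Real.rpow_le_rpow (by positivity) hX (by linarith)
  rw [Real.div_rpow hD.le hY.le, Real.rpow_add hX0, Real.rpow_one] at h1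
  have h2 : D ^ (1 + γ) = D * D ^ γ := by rw [Real.rpow_add hD, Real.rpow_one]
  have hDp : 0 < D ^ γ := Real.rpow_pos_of_pos hD _
  have hYp : 0 < Y ^ (1 + γ) := Real.rpow_pos_of_pos hY _
  have hXp : 0 < X ^ γ := Real.rpow_pos_of_pos hX0 _
  have h3 : X / (5 * D ^ γ * D) * X ^ γ ≤ t * X ^ γ := by gcongr
  refine le_trans ?_ h3
  rw [div_mul_eq_mul_div, div_le_div_iff₀ (by positivity) (by positivity)]
  rw [div_le_iff₀ hYp, h2] at h1
  nlinarith

theorem num_mid {q c ω X A t D K B V c1 : ℝ} (hq : 0 < q) (hω : 0 < ω) (hX : 0 < X)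
    (hD : 0 < D) (hK : 0 < K) (hB : 0 < B) (hV : 0 < V) (hc : c = 1 / (4 * ω))
    (h1 : q * c / X - ω * X / q ≤ A) (h2 : A ≤ t * D + X * K / B) (h3 : X ≤ c1 * q)
    (hc0 : 0 < c1) (hc1 : c1 ≤ 1 / (3 * ω)) (hc2 : c1 ≤ V * c / (8 * K)) (hc3 : c1 ≤ 1)
    (hD1 : q * V / 2 ≤ D) (hD2 : D ≤ 2 * q * V) (hDB : D ≤ B) : c / (8 * V) ≤ t * X := by
  have hcp : 0 < c := by rw [hc]; positivity
  have hXX : X ^ 2 ≤ c1 ^ 2 * q ^ 2 := by nlinarith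
  have e1 : ω * X / q ≤ q * c / (2 * X) := by
    rw [div_le_div_iff₀ hq (by positivity)]
    have : ω * c1 ^ 2 ≤ c / 2 := by
      have h5 : c1 ^ 2 ≤ (1 / (3 * ω)) ^ 2 := by gcongr
      calc ω * c1 ^ 2 ≤ ω * (1 / (3 * ω)) ^ 2 := by gcongr
        _ ≤ c / 2 := by
          rw [hc]
          have : ω * (1 / (3 * ω)) ^ 2 = 1 / (9 * ω) := by field_simp; norm_num
          rw [this, div_div]
          apply div_le_div_of_nonneg_left <;> nlinarith
    have h6 : ω * X ^ 2 ≤ c / 2 * q ^ 2 := by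
      calc ω * X ^ 2 ≤ ω * (c1 ^ 2 * q ^ 2) := by gcongr
        _ = (ω * c1 ^ 2) * q ^ 2 := by ring
        _ ≤ _ := by gcongr
    nlinarith
  have e2 : X * K / B ≤ q * c / (4 * X) := by
    rw [div_le_div_iff₀ hB (by positivity)]
    have h5 : c1 ^ 2 ≤ V * c / (8 * K) := by nlinarith
    have h6 : K * c1 ^ 2 ≤ V * c / 8 := by
      rw [le_div_iff₀ (by positivity)] at h5; linarith
    calc X * K * (4 * X) = 4 * K * X ^ 2 := by ring
      _ ≤ 4 * K * (c1 ^ 2 * q ^ 2) := by gcongr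
      _ = 4 * (K * c1 ^ 2) * q ^ 2 := by ring
      _ ≤ 4 * (V * c / 8) * q ^ 2 := by gcongr
      _ = q * c * (q * V / 2) := by ring
      _ ≤ q * c * B := by gcongr; linarith
  have e3 : q * c / (4 * X) ≤ t * D := by
    have : q * c / X = q * c / (2 * X) + q * c / (4 * X) + q * c / (4 * X) := by
      field_simp; norm_num
    linarith
  rw [div_le_iff₀ (by positivity)] at e3
  rw [div_le_iff₀ (by positivity)]
  have ht : 0 < t := by
    by_contra hn
    push Not at hn
    have : 0 < q * c := by positivity
    have : t * D * (4 * X) ≤ 0 := by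
      have := mul_nonneg hD.le hX.le
      nlinarith
    linarith
  have : q * c ≤ q * (t * X * (8 * V)) := by
    calc q * c ≤ t * D * (4 * X) := e3
      _ ≤ t * (2 * q * V) * (4 * X) := by gcongr
      _ = _ := by ring
  exact le_of_mul_le_mul_left this hq

theorem exists_shift (a b T : ℝ) (hb : 0 < b) : ∃ M : ℤ, T ≤ a + M * b ∧ a + M * b ≤ T + b := by
  refine ⟨⌈(T - a) / b⌉, ?_, ?_⟩
  · have := Int.le_ceil ((T - a) / b)
    rw [div_le_iff₀ hb] at this; linarith
  · have := (Int.ceil_lt_add_one ((T - a) / b)).le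
    have := mul_le_mul_of_nonneg_right this hb.le
    rw [add_mul, div_mul_cancel₀ _ hb.ne'] at this; linarith

def vvec (w r : Fin 3 → ℤ) : Fin 3 → ℝ := Real.sqrt 2 • toR w + toR r

theorem dot_vvec (x w r : Fin 3 → ℤ) :
    dot3 (toR x) (vvec w r) = Real.sqrt 2 * (dotZ x w : ℝ) + (dotZ x r : ℝ) := by
  rw [← dot_toR, ← dot_toR]; simp [dot3, vvec]; ring

theorem cross_vvec (w r : Fin 3 → ℤ) : cross3 (vvec w r) (toR w) = toR (crossZ r w) := by
  rw [← cross_toR]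
  funext i
  fin_cases i <;> simp [cross3, vvec] <;> ring

theorem far_pos {δ : ℝ} (hδ : 0 < δ) {x d : Fin 3 → ℝ} (h : δ < pdist x d) (hd : 0 < nrm d) :
    0 < nrm x ∧ δ * (nrm x * nrm d) < nrm (cross3 x d) := by
  have hx : 0 < nrm x := by
    rcases (nrm_nonneg x).eq_or_lt with h0 | h0
    · unfold pdist at h; rw [← h0] at h; simp at h; linarith
    · exact h0
  refine ⟨hx, ?_⟩
  unfold pdist at h
  rwa [lt_div_iff₀ (by positivity)] at h

theorem far_sine {δ : ℝ} (hδ : 0 < δ) {x y d : Fin 3 → ℝ} (h : δ < pdist x d) (hd : 0 < nrm d)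
    (hy : 0 < nrm y) : (δ - pdist y d) * (nrm x * nrm y) < nrm (cross3 x y) := by
  obtain ⟨hx, h1⟩ := far_pos hδ h hd
  have h2 := sine_triangle x y d
  have h3 : nrm (cross3 y d) = pdist y d * (nrm y * nrm d) := by
    unfold pdist; field_simp
  rw [h3] at h2
  have h4 : nrm y * (δ * (nrm x * nrm d)) < nrm y * nrm (cross3 x d) := by gcongr
  have : nrm d * ((δ - pdist y d) * (nrm x * nrm y)) < nrm d * nrm (cross3 x y) := by nlinarith
  exact lt_of_mul_lt_mul_left this hd.le

theorem pdist_tri {x y d : Fin 3 → ℝ} (hx : 0 < nrm x) (hd : 0 < nrm d)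
    (hy : 0 < nrm y) : pdist x d ≤ pdist y d + pdist x y := by
  have h2 := sine_triangle x y d
  unfold pdist
  rw [div_add_div _ _ (by positivity) (by positivity), div_le_div_iff₀ (by positivity) (by positivity)]
  have := mul_le_mul_of_nonneg_left h2 (by positivity : 0 ≤ nrm x * nrm y * nrm x * nrm d * nrm d * 1)
  have e : nrm y * (nrm (cross3 x d) * (nrm y * nrm d * (nrm x * nrm y))) ≤
    nrm y * ((nrm (cross3 y d) * (nrm x * nrm y) + nrm y * nrm d * nrm (cross3 x y)) * (nrm x * nrm d)) := by
    have := mul_le_mul_of_nonneg_left h2 (by positivity : 0 ≤ nrm y ^ 2 * nrm x * nrm d)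
    linarith
  exact le_of_mul_le_mul_left e hy

theorem toR_add (a b : Fin 3 → ℤ) : toR (a + b) = toR a + toR b := by
  funext i; simp [toR]

theorem toR_smul (k : ℤ) (a : Fin 3 → ℤ) : toR (k • a) = (k : ℝ) • toR a := by
  funext i; simp [toR]

/-- lower bound for values at integer points -/
theorem vvec_lower {x w r : Fin 3 → ℤ} (hx : x ≠ 0) (hw : w ≠ 0)
    (h : crossZ x (crossZ r w) ≠ 0) :
    1 / (4 * nrm (toR w)) / nrm (toR x) ≤ |dot3 (toR x) (vvec w r)| ∧
    (dotZ x w ≠ 0 → 1 ≤ 4 * |(dotZ x w : ℝ)| * |dot3 (toR x) (vvec w r)|) := by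
  have hx1 := one_le_nrm hx
  have hw1 := one_le_nrm hw
  have hn : ¬ (dotZ x w = 0 ∧ dotZ x r = 0) := by
    rintro ⟨h1, h2⟩
    apply h
    rw [crossZ_triple, h1, h2]; simp
  obtain ⟨k1, k2, k3⟩ := sqrt2_lower _ _ hn
  rw [← dot_vvec] at k1 k3
  refine ⟨?_, k1⟩
  rw [div_div, div_le_iff₀ (by positivity)]
  by_cases ha : dotZ x w = 0
  · have := k3 ha
    have : 1 ≤ nrm (toR w) * nrm (toR x) := by nlinarith
    nlinarith
  · have h1 := k1 ha
    have h2 := abs_dot3_le (toR x) (toR w)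
    rw [dot_toR] at h2
    have := mul_le_mul_of_nonneg_right h2 (abs_nonneg (dot3 (toR x) (vvec w r)))
    linarith

theorem sqrt_pell {p q : ℤ} (h : p ^ 2 - 2 * q ^ 2 = 1) (hp : 0 < p) (hq : 0 < q) :
    |(p : ℝ) - Real.sqrt 2 * q| ≤ 1 / q := by
  have h2 : Real.sqrt 2 * Real.sqrt 2 = 2 := Real.mul_self_sqrt (by norm_num)
  have h1 : 1 ≤ Real.sqrt 2 := by rw [Real.one_le_sqrt]; norm_num
  have hp' : (0 : ℝ) < p := by exact_mod_cast hp
  have hq' : (0 : ℝ) < q := by exact_mod_cast hq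
  have h' : (p : ℝ) ^ 2 - 2 * (q : ℝ) ^ 2 = 1 := by exact_mod_cast h
  have e : ((p : ℝ) - Real.sqrt 2 * q) * (p + Real.sqrt 2 * q) = 1 := by
    linear_combination h' - (q : ℝ) ^ 2 * h2
  have hs : (q : ℝ) ≤ p + Real.sqrt 2 * q := by nlinarith
  have : (p : ℝ) - Real.sqrt 2 * q = 1 / (p + Real.sqrt 2 * q) := by
    rw [eq_div_iff (by positivity)]; exact e
  rw [this, abs_of_pos (by positivity)]
  exact div_le_div_of_nonneg_left (by norm_num) hq' hs

def Good (ψ : ℝ → ℝ) (d : Fin 3 → ℝ) (δ N : ℝ) (u : Fin 3 → ℝ) : Prop :=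
  ∀ x : Fin 3 → ℤ, N ≤ nrm (toR x) → δ < pdist (toR x) d →
    1 / (ψ (nrm (toR x)) * nrm (toR x) ^ γ) < |dot3 (toR x) u|

theorem continuous_dot3 (x : Fin 3 → ℝ) : Continuous (fun u => dot3 x u) := by
  unfold dot3; fun_prop

theorem finite_box (R : ℝ) : {x : Fin 3 → ℤ | nrm (toR x) ≤ R}.Finite := by
  apply (Set.finite_Icc (fun _ : Fin 3 => -⌈R⌉) (fun _ : Fin 3 => ⌈R⌉)).subset
  intro x hx
  have hx' : nrm (toR x) ≤ R := hx
  have h : ∀ i, |x i| ≤ ⌈R⌉ := by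
    intro i
    have h1 := abs_le_nrm (toR x) i
    have h2 : |((x i : ℤ) : ℝ)| ≤ ⌈R⌉ := (h1.trans hx').trans (Int.le_ceil R)
    exact_mod_cast h2
  exact ⟨fun i => (abs_le.mp (h i)).1, fun i => (abs_le.mp (h i)).2⟩

theorem dist_le_nrm (a b : Fin 3 → ℝ) : dist a b ≤ nrm (a - b) := by
  rw [dist_pi_le_iff (nrm_nonneg _)]
  intro i
  rw [Real.dist_eq]
  exact abs_le_nrm (a - b) i

theorem small_stable {ψ : ℝ → ℝ} {d : Fin 3 → ℝ} {δ N : ℝ} {u : Fin 3 → ℝ}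
    (h : Good ψ d δ N u) (R : ℝ) : ∃ ε > 0, ∀ u', nrm (u' - u) < ε → ∀ x : Fin 3 → ℤ,
      nrm (toR x) ≤ R → N ≤ nrm (toR x) → δ < pdist (toR x) d →
      1 / (ψ (nrm (toR x)) * nrm (toR x) ^ γ) < |dot3 (toR x) u'| := by
  have : ∀ᶠ u' in nhds u, ∀ x ∈ {x : Fin 3 → ℤ | nrm (toR x) ≤ R}, N ≤ nrm (toR x) →
      δ < pdist (toR x) d → 1 / (ψ (nrm (toR x)) * nrm (toR x) ^ γ) < |dot3 (toR x) u'| := by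
    rw [Filter.eventually_all_finite (finite_box R)]
    intro x _
    by_cases h1 : N ≤ nrm (toR x) ∧ δ < pdist (toR x) d
    · have h2 := h x h1.1 h1.2
      have := (continuous_dot3 (toR x)).abs.continuousAt (x := u)
      filter_upwards [this.eventually (lt_mem_nhds h2)] with u' hu' _ _ using hu'
    · exact Filter.Eventually.of_forall fun u' a b => absurd ⟨a, b⟩ h1
  obtain ⟨ε, hε, hb⟩ := Metric.eventually_nhds_iff.mp this
  exact ⟨ε, hε, fun u' hu' x hx => hb (lt_of_le_of_lt (dist_le_nrm _ _) hu') x hx⟩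

theorem ne_zero_of_dotZ {s y : Fin 3 → ℤ} (h : dotZ s y = 1) : y ≠ 0 := by
  rintro rfl; simp [dotZ] at h

theorem aux_Yl {g D Y Y' C : ℝ} (hC : 0 < C) (hD : 0 < D) (hY : 0 < Y) (hY' : 0 ≤ Y')
    (h : D ^ 2 + g ^ 2 = Y' ^ 2 * Y ^ 2) (hg : C * D * Y ≤ g) : C * D ≤ Y' := by
  have h1 : (C * D * Y) ^ 2 ≤ (Y' * Y) ^ 2 := by
    have : (C * D * Y) ^ 2 ≤ g ^ 2 := by gcongr
    nlinarith [sq_nonneg D]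
  have h2 := le_of_sq_le_sq h1 (by positivity)
  exact le_of_mul_le_mul_right h2 hY

theorem aux_Yu {g D Y Y' C : ℝ} (hC : 0 < C) (hD : 0 < D) (hY : 1 ≤ Y)
    (hYD : Y ≤ D) (h : D ^ 2 + g ^ 2 = Y' ^ 2 * Y ^ 2) (hg0 : 0 ≤ g)
    (hg : g ≤ C * D * Y + Y ^ 2) : Y' ≤ (C + 2) * D := by
  have h1 : (Y' * Y) ^ 2 ≤ (g + D) ^ 2 := by nlinarith
  have h2 := le_of_sq_le_sq h1 (by linarith)
  have h3 : Y' * Y ≤ ((C + 2) * D) * Y := by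
    have : Y ^ 2 ≤ D * Y := by nlinarith
    have : D ≤ D * Y := by nlinarith
    nlinarith
  exact le_of_mul_le_mul_right h3 (by linarith)

theorem aux_Vu {D B K V' Y' g : ℝ} (hD : 0 < D) (hDK : K ≤ D) (hB3 : 3 ≤ B)
    (hY0 : 0 ≤ Y') (hY : Y' ≤ K * D) (h1 : B * D ^ 2 ≤ g) (h2 : g ≤ (B + 3) * D ^ 2)
    (h : Y' ^ 2 + g ^ 2 = V' ^ 2 * D ^ 2) : V' ≤ 5 * B * D := by
  have hB0 : 0 < B := by linarith
  have hB2 : 0 ≤ B * D ^ 2 := by positivity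
  have h2 : (V' * D) ^ 2 ≤ ((B + 3) * D ^ 2 + Y') ^ 2 := by
    have : g ^ 2 ≤ ((B + 3) * D ^ 2) ^ 2 := pow_le_pow_left₀ (hB2.trans h1) h2 2
    have : 0 ≤ (B + 3) * D ^ 2 * Y' := by positivity
    nlinarith
  have h3 := le_of_sq_le_sq h2 (by positivity)
  have h4 : V' * D ≤ (5 * B * D) * D := by
    have : K * D ≤ D ^ 2 := by nlinarith
    have : 3 * D ^ 2 ≤ B * D ^ 2 := by gcongr
    nlinarith
  exact le_of_mul_le_mul_right h4 hD

set_option maxHeartbeats 4000000 in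
theorem step {ψ : ℝ → ℝ} (hψmono : StrictMonoOn ψ (Set.Ioi 1))
    (hψunb : ∀ M : ℝ, ∃ t, 1 < t ∧ M < ψ t)
    {d : Fin 3 → ℝ} (hd : 0 < nrm d) {δ : ℝ} (hδ : 0 < δ) {N : ℝ}
    {w r s : Fin 3 → ℤ} (hs : dotZ s (crossZ r w) = 1)
    (hnear : pdist (toR (crossZ r w)) d < δ) (hgood : Good ψ d δ N (unitv (vvec w r)))
    {ε : ℝ} (hε : 0 < ε) (X₀ : ℝ) :
    ∃ w' r' s' : Fin 3 → ℤ, dotZ s' (crossZ r' w') = 1 ∧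
      pdist (toR (crossZ r' w')) d < δ ∧ Good ψ d δ N (unitv (vvec w' r')) ∧
      nrm (unitv (vvec w' r') - unitv (vvec w r)) < ε ∧ X₀ < nrm (toR (crossZ r' w')) := by
  set y := crossZ r w with hy
  have hy0 : y ≠ 0 := ne_zero_of_dotZ hs
  have hw0 : w ≠ 0 := by
    rintro rfl; apply hy0; rw [hy]; funext i; fin_cases i <;> simp [crossZ]
  set v := vvec w r with hv
  set Y := nrm (toR y) with hY
  set ω := nrm (toR w) with hω
  set V := nrm v with hV
  have hY1 : 1 ≤ Y := one_le_nrm hy0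
  have hω1 : 1 ≤ ω := one_le_nrm hw0
  have hvw : nrm (cross3 v (toR w)) = Y := by rw [hv, cross_vvec]
  have hV0 : 0 < V := by
    have := nrm_cross_le v (toR w)
    rw [hvw] at this
    by_contra hc
    have h0 : nrm v = 0 := le_antisymm (not_lt.mp hc) (nrm_nonneg _)
    rw [h0, zero_mul] at this
    linarith
  set η := δ - pdist (toR y) d with hη
  have hη0 : 0 < η := by linarith
  set C := 2 / η with hC
  have hC0 : 0 < C := by positivity
  set K := C + 2 with hK
  have hK2 : 2 ≤ K := by linarith
  have hK0 : 0 < K := by linarith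
  set c := 1 / (4 * ω) with hc
  have hc0 : 0 < c := by positivity
  obtain ⟨c1, hc1p, hc1a, hc1b, hc1c⟩ : ∃ c1 : ℝ, 0 < c1 ∧ c1 ≤ 1 / (3 * ω) ∧
      c1 ≤ V * c / (8 * K) ∧ c1 ≤ 1 := by
    refine ⟨min (min (1 / (3 * ω)) (V * c / (8 * K))) 1, ?_, ?_, ?_, ?_⟩
    · refine lt_min (lt_min ?_ ?_) one_pos <;> positivity
    · exact (min_le_left _ _).trans (min_le_left _ _)
    · exact (min_le_left _ _).trans (min_le_right _ _)
    · exact min_le_right _ _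
  set m1 := c / (8 * V) with hm1
  set m2 := c1 / (4 * V) with hm2
  set m3 := 1 / (80 * K ^ 2) with hm3
  set m4 := 1 / (5 * Y ^ (1 + γ)) with hm4
  have hm1p : 0 < m1 := by positivity
  have hm2p : 0 < m2 := by positivity
  have hm3p : 0 < m3 := by positivity
  have hm4p : 0 < m4 := by
    have : 0 < Y ^ (1 + γ) := Real.rpow_pos_of_pos (by linarith) _
    positivity
  obtain ⟨R, hR1, hRψ⟩ := hψunb (1 / m1 + 1 / m2 + 1 / m3 + 1 / m4)
  have hψX : ∀ X, R ≤ X → 1 / m1 < ψ X ∧ 1 / m2 < ψ X ∧ 1 / m3 < ψ X ∧ 1 / m4 < ψ X := by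
    intro X hX
    have h1 : ψ R ≤ ψ X := hψmono.monotoneOn hR1 (lt_of_lt_of_le hR1 hX) hX
    have a1 : 0 < 1 / m1 := by positivity
    have a2 : 0 < 1 / m2 := by positivity
    have a3 : 0 < 1 / m3 := by positivity
    have a4 : 0 < 1 / m4 := by positivity
    refine ⟨?_, ?_, ?_, ?_⟩ <;> linarith
  obtain ⟨ε', hε', hsmall⟩ := small_stable hgood R
  set D₀ := Y + K + 1 + (2 * K + 2 * Y / V + 1) / ε + (2 * K + 2 * Y / V + 1) / ε' + |X₀| / C + 1
    with hD₀
  obtain ⟨Q, hQ⟩ := exists_nat_ge (2 * ω / V + 2 * D₀ / V + 1)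
  obtain ⟨p, q, hpq, hQq, hp0, hq0⟩ := pell Q
  have hpell := sqrt_pell hpq hp0 hq0
  have hq1 : (1 : ℝ) ≤ q := by exact_mod_cast hq0
  have hQq' : (Q : ℝ) ≤ q := by exact_mod_cast hQq
  have hD₀p : 0 < D₀ := by positivity
  have hqω : 2 * ω ≤ q * V := by
    rw [← div_le_iff₀ hV0]
    have : 0 < 2 * D₀ / V := by positivity
    linarith
  have hqD : 2 * D₀ ≤ q * V := by
    rw [← div_le_iff₀ hV0]
    have : 0 < 2 * ω / V := by positivity
    linarith
  obtain ⟨z, e, he, hM⟩ := alg_step w r s hs p q hpq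
  set W := p • w + q • r with hW
  have hWv : toR W = (q : ℝ) • v + ((p : ℝ) - Real.sqrt 2 * q) • toR w := by
    rw [hW, toR_add, toR_smul, toR_smul, hv]
    funext i; simp [vvec]; ring
  set D := nrm (toR W) with hD
  have hpω : |(p : ℝ) - Real.sqrt 2 * q| * ω ≤ q * V / 2 := by
    have h1 : (1 : ℝ) / q ≤ 1 := by rw [div_le_one (by linarith)]; exact hq1
    calc _ ≤ 1 * ω := by gcongr; exact hpell.trans h1
      _ ≤ _ := by linarith
  have hD2 : D ≤ 2 * q * V := by
    rw [hD, hWv]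
    refine (nrm_add_le _ _).trans ?_
    rw [nrm_smul3, nrm_smul3, abs_of_nonneg (by linarith : (0 : ℝ) ≤ q)]
    have : 0 < q * V := by positivity
    linarith
  have hD1 : q * V / 2 ≤ D := by
    have e1 : (q : ℝ) • v = toR W + (-((p : ℝ) - Real.sqrt 2 * q)) • toR w := by
      rw [hWv]; funext i; simp; ring
    have e2 : nrm ((q : ℝ) • v) ≤ D + |(p : ℝ) - Real.sqrt 2 * q| * ω := by
      rw [e1]
      refine (nrm_add_le _ _).trans ?_
      rw [nrm_smul3, abs_neg]
    rw [nrm_smul3, abs_of_nonneg (by linarith : (0 : ℝ) ≤ q)] at e2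
    linarith
  have hDD : D₀ ≤ D := by linarith
  have hDK : Y + K + 1 ≤ D := by
    have : 0 ≤ (2 * K + 2 * Y / V + 1) / ε := by positivity
    have : 0 ≤ (2 * K + 2 * Y / V + 1) / ε' := by positivity
    have : 0 ≤ |X₀| / C := by positivity
    linarith
  have hD0 : 0 < D := by linarith
  obtain ⟨M, hMl, hMu⟩ := exists_shift (dot3 (toR z) (toR y)) (Y ^ 2) (C * D * Y) (by positivity)
  obtain ⟨hyW, s', R₀, hs', hk⟩ := hM M
  set y' := z + M • y with hy'
  set Y' := nrm (toR y') with hY'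
  have hdy : dot3 (toR y') (toR y) = dot3 (toR z) (toR y) + M * Y ^ 2 := by
    rw [hY, nrm_sq, hy', toR_add, toR_smul]; simp [dot3]; ring
  have hcy : nrm (cross3 (toR y') (toR y)) = D := by rw [cross_toR, hyW]
  have hlag := lagrange3 (toR y') (toR y)
  rw [hcy, hdy] at hlag
  set g := dot3 (toR z) (toR y) + M * Y ^ 2 with hg
  have hY'l : C * D ≤ Y' := by
    exact aux_Yl hC0 hD0 (by linarith) (nrm_nonneg _) hlag hMl
  have hg0 : 0 ≤ g := le_trans (by positivity) hMl
  have hY'u : Y' ≤ K * D := by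
    exact aux_Yu hC0 hD0 hY1 (by linarith) hlag hg0 hMu
  have hY'0 : 0 < Y' := lt_of_lt_of_le (by positivity) hY'l
  set B := D ^ γ with hB
  have hBD : D ≤ B := by
    conv_lhs => rw [← Real.rpow_one D]
    exact Real.rpow_le_rpow_of_exponent_le (by linarith) gamma_gt.le
  have hB0 : 0 < B := by linarith
  obtain ⟨k, hkl, hku⟩ := exists_shift (dot3 (toR R₀) (toR W)) (D ^ 2) (B * D ^ 2) (by positivity)
  have hRW := hk k
  set r' := R₀ + k • W with hr'
  have hdR : dot3 (toR r') (toR W) = dot3 (toR R₀) (toR W) + k * D ^ 2 := by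
    rw [hD, nrm_sq, hr', toR_add, toR_smul]; simp [dot3]; ring
  rw [← hdR] at hkl hku
  set v' := vvec W r' with hv'
  set V' := nrm v' with hV'
  have hv'W : nrm (cross3 v' (toR W)) = Y' := by rw [hv', cross_vvec, hRW]
  have hdv' : dot3 v' (toR W) = Real.sqrt 2 * D ^ 2 + dot3 (toR r') (toR W) := by
    rw [hD, nrm_sq, hv']; simp [dot3, vvec]; ring
  have hs2 : 1 ≤ Real.sqrt 2 := by rw [Real.one_le_sqrt]; norm_num
  have hs3 : Real.sqrt 2 ≤ 2 := by rw [Real.sqrt_le_left (by norm_num)]; norm_num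
  have hDsq : 0 < D ^ 2 := by positivity
  have hdv1 : B * D ^ 2 ≤ dot3 v' (toR W) := by rw [hdv']; linarith [mul_nonneg (zero_le_one.trans hs2) hDsq.le]
  have hdv2 : dot3 v' (toR W) ≤ (B + 3) * D ^ 2 := by rw [hdv']; linarith [mul_le_mul_of_nonneg_right hs3 hDsq.le]
  have hV'l : B * D ≤ V' := by
    have h1 := (le_abs_self _).trans (abs_dot3_le v' (toR W))
    have : (B * D) * D ≤ V' * D := by
      calc (B * D) * D = B * D ^ 2 := by ring
        _ ≤ _ := hdv1.trans h1
    exact le_of_mul_le_mul_right this hD0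
  have hV'0 : 0 < V' := lt_of_lt_of_le (by positivity) hV'l
  have hV'u : V' ≤ 5 * B * D := by
    have h1 := lagrange3 v' (toR W)
    rw [hv'W] at h1
    exact aux_Vu hD0 (by linarith) (by linarith) hY'0.le hY'u hdv1 hdv2 h1
  have hclose : nrm (unitv v' - unitv v) ≤ (2 * K + 2 * Y / V) / D := by
    have h1 : nrm (unitv v' - unitv (toR W)) ≤ 2 * K / D := by
      refine (unitv_close hV'0 hD0 (le_trans (by positivity) hdv1)).trans ?_
      rw [hv'W, div_le_div_iff₀ (by positivity) hD0]
      have : D ≤ V' := le_trans (le_mul_of_one_le_left hD0.le (by linarith)) hV'l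
      calc 2 * Y' * D ≤ 2 * (K * D) * D := by gcongr
        _ = 2 * K * (D * D) := by ring
        _ ≤ 2 * K * (V' * D) := by gcongr
    have h2 : nrm (unitv (toR W) - unitv v) ≤ 2 * Y / V / D := by
      have hnn : 0 ≤ dot3 (toR W) v := by
        have : dot3 (toR W) v = q * V ^ 2 + ((p : ℝ) - Real.sqrt 2 * q) * dot3 (toR w) v := by
          rw [hWv, hV, nrm_sq]; simp [dot3]; ring
        rw [this]
        have h3 : |((p : ℝ) - Real.sqrt 2 * q) * dot3 (toR w) v| ≤ q * V / 2 * V := by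
          rw [abs_mul]
          calc _ ≤ |(p : ℝ) - Real.sqrt 2 * q| * (ω * V) := by
                gcongr; exact abs_dot3_le _ _
            _ = |(p : ℝ) - Real.sqrt 2 * q| * ω * V := by ring
            _ ≤ _ := by gcongr
        have := (abs_le.mp h3).1
        have : 0 < q * V ^ 2 := by positivity
        have : q * V / 2 * V = q * V ^ 2 / 2 := by ring
        linarith
      refine (unitv_close hD0 hV0 hnn).trans ?_
      have hcr : nrm (cross3 (toR W) v) ≤ Y := by
        have : cross3 (toR W) v = (-((p : ℝ) - Real.sqrt 2 * q)) • cross3 v (toR w) := by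
          rw [hWv]; funext i; fin_cases i <;> simp [cross3] <;> ring
        rw [this, nrm_smul3, hvw, abs_neg]
        have h1 : (1 : ℝ) / q ≤ 1 := by rw [div_le_one (by linarith)]; exact hq1
        exact mul_le_of_le_one_left (by linarith) (hpell.trans h1)
      rw [div_div, mul_comm V D]
      gcongr
    have e3 : unitv v' - unitv v = (unitv v' - unitv (toR W)) + (unitv (toR W) - unitv v) := by
      abel
    rw [e3, add_div]
    exact (nrm_add_le _ _).trans (add_le_add h1 h2)
  have hcl : ∀ ε₁ > 0, (2 * K + 2 * Y / V + 1) / ε₁ ≤ D → nrm (unitv v' - unitv v) < ε₁ := by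
    intro ε₁ h1 h2
    refine lt_of_le_of_lt hclose ?_
    rw [div_le_iff₀ h1] at h2
    rw [div_lt_iff₀ hD0]
    linarith
  have hA1 : 0 ≤ (2 * K + 2 * Y / V + 1) / ε := by positivity
  have hA2 : 0 ≤ (2 * K + 2 * Y / V + 1) / ε' := by positivity
  have hA3 : 0 ≤ |X₀| / C := by positivity
  have hnear' : pdist (toR y') d ≤ δ - η / 2 := by
    have h1 := pdist_tri hY'0 hd (lt_of_lt_of_le one_pos hY1)
    have h2 : pdist (toR y') (toR y) ≤ η / 2 := by
      unfold pdist
      rw [hcy, div_le_iff₀ (by positivity)]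
      have : η / 2 * C = 1 := by rw [hC]; field_simp
      calc D = η / 2 * C * D := by rw [this, one_mul]
        _ = η / 2 * (C * D * 1) := by ring
        _ ≤ _ := by gcongr
    linarith
  refine ⟨W, r', s', by rw [hRW]; exact hs', by rw [hRW]; linarith, ?_, hcl ε hε (by linarith), ?_⟩
  swap
  · rw [hRW]
    have : |X₀| / C < D := by linarith
    rw [div_lt_iff₀ hC0] at this
    linarith [le_abs_self X₀]
  intro x hxN hxd
  rcases le_or_gt (nrm (toR x)) R with hxR | hxR
  · exact hsmall _ (hcl ε' hε' (by linarith)) x hxR hxN hxd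
  set X := nrm (toR x) with hX
  obtain ⟨hψ1, hψ2, hψ3, hψ4⟩ := hψX X hxR.le
  have hX1 : 1 ≤ X := by linarith
  have hX0 : 0 < X := by linarith
  have hx0 : x ≠ 0 := by
    rintro rfl
    have : X = 0 := by rw [hX]; simp [nrm, dot3, toR]
    linarith
  set t := |dot3 (toR x) (unitv v')| with ht
  have ht0 : 0 ≤ t := abs_nonneg _
  have htv : |dot3 (toR x) v'| = t * V' := by
    rw [ht, dot3_unitv, abs_div, abs_of_pos hV'0]; field_simp
  have hfy := far_sine hδ hxd hd (lt_of_lt_of_le one_pos hY1)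
  have hfy' := far_sine hδ hxd hd hY'0
  have hxy : crossZ x y ≠ 0 := by
    intro h
    rw [cross_toR, h] at hfy
    have : nrm (toR (0 : Fin 3 → ℤ)) = 0 := by simp [nrm, dot3, toR]
    rw [this] at hfy
    have : 0 < (δ - pdist (toR y) d) * (nrm (toR x) * nrm (toR y)) := by positivity
    linarith
  have hxy' : crossZ x y' ≠ 0 := by
    intro h
    rw [cross_toR, h] at hfy'
    have : nrm (toR (0 : Fin 3 → ℤ)) = 0 := by simp [nrm, dot3, toR]
    rw [this] at hfy'
    have : 0 < δ - pdist (toR y') d := by linarith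
    have : 0 < (δ - pdist (toR y') d) * (nrm (toR x) * nrm (toR y')) := by positivity
    linarith
  have hW0 : W ≠ 0 := ne_zero_of_dotZ he
  have hI1 : |dot3 (toR x) (toR W)| ≤ t * D + X * K / B := by
    have h1 := binet (toR x) (toR W) v'
    rw [hv'W, htv] at h1
    have h2 : V' * |dot3 (toR x) (toR W)| ≤ V' * (t * D + X * K / B) := by
      refine h1.trans ?_
      have : X * Y' ≤ V' * (X * K / B) := by
        calc X * Y' ≤ X * (K * D) := by gcongr
          _ = (B * D) * (X * K / B) := by field_simp
          _ ≤ _ := by gcongr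
      linarith
    exact le_of_mul_le_mul_left h2 hV'0
  have hlow' := vvec_lower (x := x) (w := W) (r := r') hx0 hW0 (by rw [hRW]; exact hxy')
  rcases le_or_gt X (c1 * q) with hXc | hXc
  · apply num_final hX0 hm1p hψ1
    apply num_lin hX1 ht0
    have hlow := (vvec_lower (x := x) (w := w) (r := r) hx0 hw0 hxy).1
    refine num_mid (by linarith) (by linarith) hX0 hD0 hK0 hB0 hV0 hc ?_ hI1 hXc hc1p hc1a hc1b
      hc1c hD1 hD2 hBD
    have e1 : dot3 (toR x) (toR W) = q * dot3 (toR x) v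
        + ((p : ℝ) - Real.sqrt 2 * q) * dot3 (toR x) (toR w) := by
      rw [hWv]; simp [dot3]; ring
    have e2 : |((p : ℝ) - Real.sqrt 2 * q) * dot3 (toR x) (toR w)| ≤ ω * X / q := by
      rw [abs_mul]
      calc _ ≤ 1 / (q : ℝ) * (X * ω) := by
            gcongr; exact abs_dot3_le _ _
        _ = _ := by ring
    have e3 : q * c / X ≤ |q * dot3 (toR x) v| := by
      rw [abs_mul, abs_of_pos (by linarith : (0 : ℝ) < q), mul_div_assoc]
      gcongr
    have e4 := abs_sub_abs_le_abs_sub (q * dot3 (toR x) v)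
      (-(((p : ℝ) - Real.sqrt 2 * q) * dot3 (toR x) (toR w)))
    rw [abs_neg, sub_neg_eq_add, ← e1] at e4
    linarith
  by_cases hα : dotZ x W = 0
  · apply num_final hX0 hm4p hψ4
    have e1 : crossZ x y' = - (dotZ x r' • W) := by
      rw [← hRW, crossZ_triple, hα]; simp
    have e2 : nrm (cross3 (toR x) (toR y')) = |(dotZ x r' : ℝ)| * D := by
      rw [cross_toR, e1, ← neg_smul, toR_smul, nrm_smul3]; simp [hD]
    have e3 : X ≤ |(dotZ x r' : ℝ)| := by
      rw [e2] at hfy'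
      have h1 : η / 2 * (X * (C * D)) ≤ (δ - pdist (toR y') d) * (X * Y') := by
        gcongr
        · linarith
        · linarith
      have : η / 2 * C = 1 := by rw [hC]; field_simp
      have h2 : X * D ≤ |(dotZ x r' : ℝ)| * D := by
        calc X * D = η / 2 * C * (X * D) := by rw [this, one_mul]
          _ = η / 2 * (X * (C * D)) := by ring
          _ ≤ _ := h1.trans hfy'.le
      exact le_of_mul_le_mul_right h2 hD0
    have e4 : |(dotZ x r' : ℝ)| = t * V' := by
      rw [← htv, hv', dot_vvec, hα]; simp
    have e5 : X / (5 * D ^ γ * D) ≤ t := by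
      rw [div_le_iff₀ (by positivity)]
      calc X ≤ t * V' := by rw [← e4]; exact e3
        _ ≤ _ := by gcongr
    have e6 : D / Y ≤ X := by
      rw [div_le_iff₀ (by linarith)]
      have hyW0 : dotZ y W = 0 := by
        rw [hW, hy]; simp [dotZ, crossZ]; ring
      have h1 : crossZ e (crossZ W (crossZ x y)) = 0 := by
        have a1 : dotZ W y = 0 := by rw [← hyW0]; unfold dotZ; ring
        have a2 : dotZ W x = 0 := by rw [← hα]; unfold dotZ; ring
        rw [crossZ_triple W, a1, a2]
        funext i; fin_cases i <;> simp [crossZ]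
      rw [crossZ_triple, he, one_smul, sub_eq_zero] at h1
      have h2 : dotZ e (crossZ x y) ≠ 0 := by
        intro h; rw [h, zero_smul] at h1; exact hxy h1.symm
      have h3 : nrm (cross3 (toR x) (toR y)) = |(dotZ e (crossZ x y) : ℝ)| * D := by
        rw [cross_toR, ← h1, toR_smul, nrm_smul3]; rw [h1]
      have h4 : (1 : ℝ) ≤ |(dotZ e (crossZ x y) : ℝ)| := by exact_mod_cast Int.one_le_abs h2
      have h5 := nrm_cross_le (toR x) (toR y)
      rw [h3] at h5
      exact (le_mul_of_one_le_left hD0.le h4).trans h5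
    exact num_P hD0 (by linarith) e6 e5
  · have hα1 : (1 : ℝ) ≤ |(dotZ x W : ℝ)| := by exact_mod_cast Int.one_le_abs hα
    have hl := hlow'.2 hα
    rw [dot_toR] at hI1
    rw [htv] at hl
    set α := |(dotZ x W : ℝ)| with hαd
    rcases le_or_gt (α / 2) (t * D) with hcase | hcase
    · apply num_final hX0 hm2p hψ2
      apply num_lin hX1 ht0
      have h1 : (1 : ℝ) / 2 ≤ t * D := by linarith
      have h2 : (1 : ℝ) / 2 ≤ t * (2 * q * V) := h1.trans (by gcongr)
      rw [hm2, div_le_iff₀ (by positivity)]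
      calc c1 = c1 * (1 / 2 * 2) := by ring
        _ ≤ c1 * (t * (2 * q * V) * 2) := by gcongr
        _ = t * (c1 * q) * (4 * V) := by ring
        _ ≤ _ := by gcongr
    · apply num_final hX0 hm3p hψ3
      have h1 : α / 2 ≤ X * K / B := by linarith
      rw [le_div_iff₀ hB0] at h1
      have h2 : α * B ≤ 2 * K * X := by linarith
      apply num_ii hD0 (by linarith)
      · rw [div_le_iff₀ (by positivity)]
        have := le_mul_of_one_le_left hB0.le hα1
        linarith
      · rw [div_le_iff₀ (by positivity)]
        have h3 : 4 * α * (t * V') ≤ 4 * α * (t * (5 * B * D)) := by gcongr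
        have h4 : 4 * α * (t * (5 * B * D)) = 20 * t * D * (α * B) := by ring
        have h5 : 20 * t * D * (α * B) ≤ 20 * t * D * (2 * K * X) := by gcongr
        linarith

theorem pdist_smul {k : ℝ} (hk : k ≠ 0) (y d : Fin 3 → ℝ) : pdist (k • y) d = pdist y d := by
  unfold pdist
  have : cross3 (k • y) d = k • cross3 y d := by
    funext i; fin_cases i <;> simp [cross3] <;> ring
  rw [this, nrm_smul3, nrm_smul3, mul_assoc, mul_div_mul_left _ _ (abs_ne_zero.mpr hk)]

theorem coprime_factor (a b : ℤ) (h : a ≠ 0) :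
    ∃ g a' b' m n : ℤ, g ≠ 0 ∧ a = g * a' ∧ b = g * b' ∧ m * a' + n * b' = 1 := by
  have hpos : 0 < Int.gcd a b := Int.gcd_pos_of_ne_zero_left b h
  obtain ⟨a', b', hc, ha, hb⟩ := Int.exists_gcd_one hpos
  have hc' : IsCoprime a' b' := Int.isCoprime_iff_gcd_eq_one.mpr hc
  obtain ⟨m, n, hmn⟩ := hc'
  refine ⟨Int.gcd a b, a', b', m, n, by exact_mod_cast hpos.ne', ?_, ?_, hmn⟩
  · rw [mul_comm]; exact ha
  · rw [mul_comm]; exact hb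

theorem exists_frame (y₀ : Fin 3 → ℤ) (h : y₀ 0 ≠ 0) :
    ∃ (k : ℤ) (w r s : Fin 3 → ℤ), k ≠ 0 ∧ y₀ = k • crossZ r w ∧ dotZ s (crossZ r w) = 1 := by
  obtain ⟨g, a', b', m, n, hg, ha, hb, hmn⟩ := coprime_factor (y₀ 0) (y₀ 1) h
  obtain ⟨k, g', c', i, j, hk, hg', hc', hij⟩ := coprime_factor g (y₀ 2) hg
  refine ⟨k, ![-c' * m, -c' * n, g'], ![-b', a', 0], ![i * m, i * n, j], hk, ?_, ?_⟩
  · funext l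
    fin_cases l
    · simp [crossZ]; rw [ha, hg']; ring
    · simp [crossZ]; rw [hb, hg']; ring
    · simp [crossZ]; rw [hc']; linear_combination (- k * c') * hmn
  · simp [crossZ, dotZ]
    linear_combination hij + (i * g' + j * c') * hmn

theorem exists_start {d : Fin 3 → ℝ} (hd : 0 < nrm d) {δ : ℝ} (hδ : 0 < δ) :
    ∃ w r s : Fin 3 → ℤ, dotZ s (crossZ r w) = 1 ∧ pdist (toR (crossZ r w)) d < δ := by
  have hnear : ∀ t : ℝ, ∃ a : ℤ, a ≠ 0 ∧ |(a : ℝ) - t| ≤ 1 := by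
    intro t
    have h1 := Int.floor_le t
    have h2 := Int.lt_floor_add_one t
    by_cases h : ⌊t⌋ = 0
    · refine ⟨1, one_ne_zero, ?_⟩
      rw [h] at h1 h2
      rw [abs_le]; push_cast at *; constructor <;> linarith
    · refine ⟨⌊t⌋, h, ?_⟩
      rw [abs_le]; constructor <;> linarith
  choose f hf0 hf using hnear
  set T : ℝ := (2 / δ + 3) / nrm d with hT
  set y₀ : Fin 3 → ℤ := fun i => f (T * d i) with hy₀
  obtain ⟨k, w, r, s, hk, hy, hs⟩ := exists_frame y₀ (hf0 _)
  refine ⟨w, r, s, hs, ?_⟩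
  have hk' : (k : ℝ) ≠ 0 := by exact_mod_cast hk
  rw [← pdist_smul hk', ← toR_smul, ← hy]
  set e : Fin 3 → ℝ := toR y₀ - T • d with he
  have hei : ∀ i, |e i| ≤ 1 := by
    intro i
    simp only [he, toR, hy₀, Pi.sub_apply, Pi.smul_apply, smul_eq_mul]
    exact hf _
  have hen : nrm e ≤ 2 := by
    apply le_of_sq_le_sq _ (by norm_num)
    rw [nrm_sq]; unfold dot3
    have := fun i => sq_le_one_iff_abs_le_one (e i) |>.mpr (hei i)
    nlinarith [this 0, this 1, this 2]
  have hc : cross3 (toR y₀) d = cross3 e d := by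
    funext i; fin_cases i <;> simp [cross3, he] <;> ring
  have hT0 : 0 < T := by positivity
  have hTd : T * nrm d = 2 / δ + 3 := by rw [hT]; field_simp
  have hl : 2 / δ + 1 ≤ nrm (toR y₀) := by
    have h1 : T • d = toR y₀ + (-1 : ℝ) • e := by
      funext i; simp [he]
    have h2 := nrm_add_le (toR y₀) ((-1 : ℝ) • e)
    rw [← h1, nrm_smul3, nrm_smul3, abs_of_pos hT0, hTd] at h2
    norm_num at h2
    linarith
  have hy0 : 0 < nrm (toR y₀) := lt_of_lt_of_le (by positivity) hl
  unfold pdist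
  rw [hc, div_lt_iff₀ (by positivity)]
  have h1 := nrm_cross_le e d
  have h2 : 2 < δ * nrm (toR y₀) := by
    have : δ * (2 / δ + 1) ≤ δ * nrm (toR y₀) := by gcongr
    have e : δ * (2 / δ + 1) = 2 + δ := by field_simp
    linarith
  calc _ ≤ nrm e * nrm d := h1
    _ ≤ 2 * nrm d := by gcongr
    _ < δ * nrm (toR y₀) * nrm d := by gcongr
    _ = _ := by ring

theorem nrm_toR_zero : nrm (toR 0) = 0 := by simp [nrm, dot3, toR]

theorem vvec_pos {w r s : Fin 3 → ℤ} (hs : dotZ s (crossZ r w) = 1) : 0 < nrm (vvec w r) := by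
  have h1 := one_le_nrm (ne_zero_of_dotZ hs)
  have := nrm_cross_le (vvec w r) (toR w)
  rw [cross_vvec] at this
  by_contra hc
  have h0 : nrm (vvec w r) = 0 := le_antisymm (not_lt.mp hc) (nrm_nonneg _)
  rw [h0, zero_mul] at this
  linarith

theorem start_good {ψ : ℝ → ℝ} (hψmono : StrictMonoOn ψ (Set.Ioi 1))
    (hψunb : ∀ M : ℝ, ∃ t, 1 < t ∧ M < ψ t)
    {d : Fin 3 → ℝ} (hd : 0 < nrm d) {δ : ℝ} (hδ : 0 < δ)
    {w r s : Fin 3 → ℤ} (hs : dotZ s (crossZ r w) = 1)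
    (hnear : pdist (toR (crossZ r w)) d < δ) : ∃ N, Good ψ d δ N (unitv (vvec w r)) := by
  have hV := vvec_pos hs
  have hy0 := ne_zero_of_dotZ hs
  have hw0 : w ≠ 0 := by
    rintro rfl; apply hy0; funext i; fin_cases i <;> simp [crossZ]
  have hω := one_le_nrm hw0
  have hY := one_le_nrm hy0
  set m := 1 / (4 * nrm (toR w)) / nrm (vvec w r) with hm
  have hm0 : 0 < m := by positivity
  obtain ⟨R, hR1, hRψ⟩ := hψunb (1 / m)
  refine ⟨R, ?_⟩
  intro x hxR hxd
  have hX1 : 1 ≤ nrm (toR x) := by linarith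
  have hψ : ψ R ≤ ψ (nrm (toR x)) := hψmono.monotoneOn hR1 (lt_of_lt_of_le hR1 hxR) hxR
  apply num_final (by linarith) hm0 (by linarith)
  apply num_lin hX1 (abs_nonneg _)
  have hx0 : x ≠ 0 := by
    rintro rfl; rw [nrm_toR_zero] at hX1; linarith
  have hfy := far_sine hδ hxd hd (lt_of_lt_of_le one_pos hY)
  have hxy : crossZ x (crossZ r w) ≠ 0 := by
    intro h
    rw [cross_toR, h, nrm_toR_zero] at hfy
    have : 0 < δ - pdist (toR (crossZ r w)) d := by linarith
    have : 0 < (δ - pdist (toR (crossZ r w)) d) * (nrm (toR x) * nrm (toR (crossZ r w))) := by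
      positivity
    linarith
  have hl := (vvec_lower hx0 hw0 hxy).1
  rw [dot3_unitv, abs_div, abs_of_pos hV, hm]
  rw [div_le_iff₀ (by linarith)] at hl
  rw [div_mul_eq_mul_div]
  gcongr

theorem dot_unitv_ne {w r s x : Fin 3 → ℤ} (hs : dotZ s (crossZ r w) = 1) (hx : x ≠ 0)
    (h : nrm (toR x) < nrm (toR (crossZ r w))) : dot3 (toR x) (unitv (vvec w r)) ≠ 0 := by
  have hV := vvec_pos hs
  rw [dot3_unitv]
  refine div_ne_zero ?_ hV.ne'
  rw [dot_vvec]
  apply (sqrt2_lower _ _ _).2.1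
  rintro ⟨h1, h2⟩
  have h3 : crossZ s (crossZ x (crossZ r w)) = 0 := by
    rw [crossZ_triple x, h1, h2]
    funext i; fin_cases i <;> simp [crossZ]
  rw [crossZ_triple, hs, one_smul, sub_eq_zero] at h3
  have h4 : dotZ s x ≠ 0 := by
    intro h0; rw [h0, zero_smul] at h3; exact hx h3
  have h5 : nrm (toR x) = |(dotZ s x : ℝ)| * nrm (toR (crossZ r w)) := by
    conv_lhs => rw [h3, toR_smul, nrm_smul3]
  have h6 : (1 : ℝ) ≤ |(dotZ s x : ℝ)| := by exact_mod_cast Int.one_le_abs h4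
  have := nrm_nonneg (toR (crossZ r w))
  nlinarith

/-- Main corollary: optimality of the exponent γ in Schmidt's theorem. -/
theorem stmt13 (ψ : ℝ → ℝ) (hψpos : ∀ t, 1 < t → 0 < ψ t)
    (hψmono : StrictMonoOn ψ (Set.Ioi 1)) (hψunb : ∀ M : ℝ, ∃ t, 1 < t ∧ M < ψ t)
    (d : Fin 3 → ℝ) (hd : d ≠ 0) (δ : ℝ) (hδ : 0 < δ) :
    ∃ u : Fin 3 → ℝ, nrm u = 1 ∧
      (∀ a b c : ℚ, (a : ℝ) * u 0 + (b : ℝ) * u 1 + (c : ℝ) * u 2 = 0 →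
        a = 0 ∧ b = 0 ∧ c = 0) ∧
      ∃ N : ℝ, ∀ x : Fin 3 → ℤ, N ≤ nrm (toR x) → δ < pdist (toR x) d →
        1 / (ψ (nrm (toR x)) * nrm (toR x) ^ γ) ≤ |dot3 (toR x) u| := by
  have hd' : 0 < nrm d :=
    lt_of_le_of_ne (nrm_nonneg d) (fun h => hd (nrm_eq_zero h.symm))
  obtain ⟨w₀, r₀, s₀, hs₀, hn₀⟩ := exists_start hd' hδ
  obtain ⟨N, hN⟩ := start_good hψmono hψunb hd' hδ hs₀ hn₀
  set S : Set (Fin 3 → ℝ) := {u | ∃ w r s : Fin 3 → ℤ, dotZ s (crossZ r w) = 1 ∧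
    pdist (toR (crossZ r w)) d < δ ∧ Good ψ d δ N (unitv (vvec w r)) ∧ u = unitv (vvec w r)}
    with hS
  have hu₀ : unitv (vvec w₀ r₀) ∈ S := ⟨w₀, r₀, s₀, hs₀, hn₀, hN, rfl⟩
  have hcont : Continuous nrm := by
    unfold nrm dot3; fun_prop
  have hnrm : ∀ u ∈ closure S, nrm u = 1 := by
    intro u hu
    have hcl : IsClosed {u : Fin 3 → ℝ | nrm u = 1} := isClosed_eq hcont continuous_const
    refine closure_minimal ?_ hcl hu
    rintro u ⟨w, r, s, hs, -, -, rfl⟩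
    exact nrm_unitv (vvec_pos hs)
  have hineq : ∀ u ∈ closure S, ∀ x : Fin 3 → ℤ, N ≤ nrm (toR x) → δ < pdist (toR x) d →
        1 / (ψ (nrm (toR x)) * nrm (toR x) ^ γ) ≤ |dot3 (toR x) u| := by
    intro u hu x hx hxd
    have hcl : IsClosed {u : Fin 3 → ℝ |
        1 / (ψ (nrm (toR x)) * nrm (toR x) ^ γ) ≤ |dot3 (toR x) u|} :=
      isClosed_le continuous_const (continuous_dot3 _).abs
    refine closure_minimal ?_ hcl hu
    rintro u ⟨w, r, s, hs, -, hg, rfl⟩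
    exact (hg x hx hxd).le
  haveI : CompleteSpace (closure S) := isClosed_closure.completeSpace_coe
  haveI : Nonempty (closure S) := ⟨⟨_, subset_closure hu₀⟩⟩
  set O : {x : Fin 3 → ℤ // x ≠ 0} → Set (closure S) :=
    fun x => {u | dot3 (toR x.1) u.1 ≠ 0} with hO
  have hopen : ∀ x, IsOpen (O x) := fun x =>
    isOpen_ne_fun ((continuous_dot3 _).comp continuous_subtype_val) continuous_const
  have hdense : ∀ x, Dense (O x) := by
    rintro ⟨x, hx⟩
    rw [Metric.dense_iff]
    rintro ⟨u, hu⟩ ε hε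
    obtain ⟨u₁, ⟨w, r, s, hs, hn, hg, rfl⟩, hu₁⟩ := Metric.mem_closure_iff.mp hu (ε / 2) (by linarith)
    obtain ⟨w', r', s', hs', hn', hg', hc, hX⟩ :=
      step hψmono hψunb hd' hδ hs hn hg (by linarith : 0 < ε / 2) (nrm (toR x))
    have hmem : unitv (vvec w' r') ∈ closure S := subset_closure ⟨w', r', s', hs', hn', hg', rfl⟩
    refine ⟨⟨_, hmem⟩, ?_, dot_unitv_ne hs' hx hX⟩
    rw [Metric.mem_ball, Subtype.dist_eq]
    have h1 := dist_triangle (unitv (vvec w' r')) (unitv (vvec w r)) u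
    have h2 := dist_le_nrm (unitv (vvec w' r')) (unitv (vvec w r))
    rw [dist_comm] at hu₁
    linarith
  obtain ⟨⟨u, hu⟩, hmem⟩ := (dense_iInter_of_isOpen hopen hdense).nonempty
  rw [Set.mem_iInter] at hmem
  refine ⟨u, hnrm u hu, ?_, N, hineq u hu⟩
  intro a b c h
  by_contra hne
  set x : Fin 3 → ℤ := ![a.num * b.den * c.den, b.num * a.den * c.den, c.num * a.den * b.den]
    with hx
  have ha : (a.den : ℝ) ≠ 0 := by exact_mod_cast a.den_nz
  have hb : (b.den : ℝ) ≠ 0 := by exact_mod_cast b.den_nz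
  have hc : (c.den : ℝ) ≠ 0 := by exact_mod_cast c.den_nz
  have hx0 : x ≠ 0 := by
    intro h0
    have e0 := congrFun h0 0
    have e1 := congrFun h0 1
    have e2 := congrFun h0 2
    simp [hx] at e0 e1 e2
    tauto
  apply hmem ⟨x, hx0⟩
  have h' := h
  rw [Rat.cast_def a, Rat.cast_def b, Rat.cast_def c] at h'
  simp [dot3, toR, hx]
  field_simp at h'
  linarith
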